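/- arXiv:2302.02640 — 2 statements merged into one kernel-verified Lean document; each statement's English description precedes it below -/
import Mathlib

section
/- For every integer k ≥ 0 and every index α ∈ Λ_k, there exist k+1 polynomial functions p₀, …, p_k on ℝ³, where for each i ≤ k the polynomial p_i has degree at most i, such that 𝒲_α(x) = Σ_{i=0}^{k} p_i(x)/(|x|²+1)^{i+1/2} for all x ∈ ℝ³. -/
open MeasureTheory Real Filter Metric
open scoped RealInnerProductSpace BigOperators

noncomputable section

abbrev E3 := EuclideanSpace ℝ (Fin 3)
abbrev E4 := EuclideanSpace ℝ (Fin 4)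

/-- The index set `Λ = {(k,ℓ,m) : ℓ ≤ k, |m| ≤ ℓ}`. -/
def memLam (α : ℕ × ℕ × ℤ) : Prop := α.2.1 ≤ α.1 ∧ α.2.2.natAbs ≤ α.2.1

/-- Associated Legendre function `P_ℓ^m(t) = ((-1)^m/(2^ℓ ℓ!)) (1-t²)^{m/2} (d/dt)^{ℓ+m}(t²-1)^ℓ`. -/
def legendreP (l m : ℕ) (t : ℝ) : ℝ :=
  ((-1:ℝ)^m / (2^l * (Nat.factorial l))) * (Real.sqrt (1 - t^2))^m *
    (Polynomial.derivative^[l+m] ((Polynomial.X^2 - 1 : Polynomial ℝ)^l)).eval t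

/-- Normalized associated Legendre function `K_ℓ^m = (-1)^m √((ℓ-m)!/(ℓ+m)!) P_ℓ^m`. -/
def Kfun (l m : ℕ) (t : ℝ) : ℝ :=
  (-1:ℝ)^m * Real.sqrt ((Nat.factorial (l-m)) / (Nat.factorial (l+m))) * legendreP l m t

/-- The angular factor `y_m`. -/
def ymfun (m : ℤ) (φ : ℝ) : ℝ :=
  if m = 0 then 1 / Real.sqrt 2
  else if 0 < m then Real.cos (m * φ)
  else Real.sin (|m| * φ)

/-- Real spherical harmonics `Y_{ℓ,m}` on `S²`. -/
def Y2fun (l : ℕ) (m : ℤ) (φ θ : ℝ) : ℝ :=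
  Real.sqrt ((2*l+1)/(2*π)) * Kfun l m.natAbs (Real.cos θ) * ymfun m φ

/-- Normalization constants `a_{k,ℓ} = ((k+1)π/2)·(k+ℓ+1)!/(k-ℓ)!`. -/
def akl (k l : ℕ) : ℝ :=
  ((k+1) * π / 2) * (Nat.factorial (k+l+1)) / (Nat.factorial (k-l))

/-- `d`-th derivative of the Chebyshev polynomial of the first kind `T_n`, evaluated at `t`. -/
def chebDeriv (n d : ℕ) (t : ℝ) : ℝ :=
  (Polynomial.derivative^[d] (Polynomial.Chebyshev.T ℝ (n : ℤ))).eval t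

/-- Spherical harmonic `𝒴_α` on `S³`, as a function of the spherical coordinates `(φ,θ,χ)`:
`𝒴_α = a_{k,ℓ}^{-1/2} (sin χ)^ℓ T_{k+1}^{(ℓ+1)}(cos χ) Y_{ℓ,m}(φ,θ)`. -/
def Yfun (α : ℕ × ℕ × ℤ) (φ θ χ : ℝ) : ℝ :=
  (1 / Real.sqrt (akl α.1 α.2.1)) * (Real.sin χ)^α.2.1 *
    chebDeriv (α.1+1) (α.2.1+1) (Real.cos χ) * Y2fun α.2.1 α.2.2 φ θ

/-- The azimuthal spherical coordinate `φ` of `π⁻¹(x)`. -/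
def sphPhi (x : E3) : ℝ := Complex.arg ⟨x 0, x 1⟩

/-- The polar spherical coordinate `θ` of `π⁻¹(x)`, i.e. `cos θ = x₃/|x|`. -/
def sphTheta (x : E3) : ℝ := Real.arccos (x 2 / ‖x‖)

/-- The spherical coordinate `χ` of `π⁻¹(x)`, i.e. `cos χ = (|x|²-1)/(|x|²+1)`. -/
def sphChi (x : E3) : ℝ := Real.arccos ((‖x‖^2 - 1) / (‖x‖^2 + 1))

/-- The Arar–Boulmezaoud function `𝒲_α(x) = (2/(|x|²+1))^{1/2} 𝒴_α(π⁻¹(x))`. -/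
def Wfun (α : ℕ × ℕ × ℤ) (x : E3) : ℝ :=
  Real.sqrt (2 / (‖x‖^2 + 1)) * Yfun α (sphPhi x) (sphTheta x) (sphChi x)

/-- Homogenization at `c = z / r`, with `R` standing for `r²`, of a polynomial whose coefficients
of parity other than that of `n` vanish. -/
lemma exists_mvPolynomial_eq_pow_mul_eval (Q : Polynomial ℝ) (n : ℕ) (hdeg : Q.natDegree ≤ n)
    (hpar : ∀ j ≤ n, ¬ 2 ∣ n - j → Q.coeff j = 0) {σ : Type*} (Z R : MvPolynomial σ ℝ)
    (hZ : Z.totalDegree ≤ 1) (hR : R.totalDegree ≤ 2) :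
    ∃ H : MvPolynomial σ ℝ, H.totalDegree ≤ n ∧
      ∀ (v : σ → ℝ) (r c : ℝ), r * c = MvPolynomial.eval v Z → r ^ 2 = MvPolynomial.eval v R →
        r ^ n * Q.eval c = MvPolynomial.eval v H := by
  refine ⟨∑ j ∈ Finset.range (n + 1), MvPolynomial.C (Q.coeff j) * Z ^ j * R ^ ((n - j) / 2),
    ?_, ?_⟩
  · refine MvPolynomial.totalDegree_finsetSum_le fun j hj => ?_
    have hj' : j ≤ n := by simpa [Nat.lt_succ_iff] using hj
    have h₁ := MvPolynomial.totalDegree_mul (MvPolynomial.C (Q.coeff j) * Z ^ j) (R ^ ((n - j) / 2))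
    have h₂ := MvPolynomial.totalDegree_mul (MvPolynomial.C (Q.coeff j)) (Z ^ j)
    have h₃ := (MvPolynomial.totalDegree_pow Z j).trans (Nat.mul_le_mul_left j hZ)
    have h₄ := (MvPolynomial.totalDegree_pow R ((n - j) / 2)).trans (Nat.mul_le_mul_left _ hR)
    rw [MvPolynomial.totalDegree_C] at h₂
    omega
  · intro v r c hc hr
    rw [Polynomial.eval_eq_sum_range' (Nat.lt_succ_of_le hdeg), Finset.mul_sum, map_sum]
    refine Finset.sum_congr rfl fun j hj => ?_
    have hj' : j ≤ n := by simpa [Nat.lt_succ_iff] using hj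
    simp only [map_mul, map_pow, MvPolynomial.eval_C, ← hc, ← hr]
    by_cases h2 : 2 ∣ n - j
    · rw [← pow_mul, Nat.mul_div_cancel' h2, mul_pow]
      nth_rewrite 1 [← Nat.add_sub_of_le hj']
      rw [pow_add]
      ring
    · simp [hpar j hj' h2]

lemma coeff_iterate_derivative_X_sq_sub_one_pow (l d j : ℕ) (h : ¬ 2 ∣ j + d) :
    (Polynomial.derivative^[d] ((Polynomial.X ^ 2 - 1 : Polynomial ℝ) ^ l)).coeff j = 0 := by
  have hexp : (Polynomial.X ^ 2 - 1 : Polynomial ℝ) ^ l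
      = Polynomial.expand ℝ 2 ((Polynomial.X - 1) ^ l) := by simp
  rw [Polynomial.coeff_iterate_derivative, hexp, Polynomial.coeff_expand two_pos, if_neg h,
    smul_zero]

lemma natDegree_iterate_derivative_X_sq_sub_one_pow_le (l d : ℕ) :
    (Polynomial.derivative^[d] ((Polynomial.X ^ 2 - 1 : Polynomial ℝ) ^ l)).natDegree
      ≤ 2 * l - d := by
  refine (Polynomial.natDegree_iterate_derivative _ _).trans (Nat.sub_le_sub_right ?_ d)
  have h : (Polynomial.X ^ 2 - 1 : Polynomial ℝ).natDegree ≤ 2 := by compute_degree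
  calc _ ≤ l * (Polynomial.X ^ 2 - 1 : Polynomial ℝ).natDegree := Polynomial.natDegree_pow_le
    _ ≤ 2 * l := by nlinarith

lemma exists_mvPolynomial_re_im_pow {σ : Type*} (X Y : MvPolynomial σ ℝ)
    (hX : X.totalDegree ≤ 1) (hY : Y.totalDegree ≤ 1) (m : ℕ) :
    ∃ A B : MvPolynomial σ ℝ, A.totalDegree ≤ m ∧ B.totalDegree ≤ m ∧
      ∀ v : σ → ℝ, (⟨MvPolynomial.eval v X, MvPolynomial.eval v Y⟩ : ℂ) ^ m
        = ⟨MvPolynomial.eval v A, MvPolynomial.eval v B⟩ := by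
  induction m with
  | zero => exact ⟨1, 0, by simp, by simp, fun v => by simp [Complex.ext_iff]⟩
  | succ m ih =>
    obtain ⟨A, B, hA, hB, h⟩ := ih
    refine ⟨A * X - B * Y, A * Y + B * X, ?_, ?_, fun v => ?_⟩
    · refine (MvPolynomial.totalDegree_sub _ _).trans (max_le ?_ ?_) <;>
        exact (MvPolynomial.totalDegree_mul _ _).trans (by omega)
    · refine (MvPolynomial.totalDegree_add _ _).trans (max_le ?_ ?_) <;>
        exact (MvPolynomial.totalDegree_mul _ _).trans (by omega)
    · rw [pow_succ, h]
      simp [Complex.ext_iff]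

lemma complex_pow_eq_norm_arg (z : ℂ) (m : ℕ) :
    z ^ m = ⟨‖z‖ ^ m * Real.cos (m * z.arg), ‖z‖ ^ m * Real.sin (m * z.arg)⟩ := by
  conv_lhs => rw [← Complex.norm_mul_cos_add_sin_mul_I z]
  rw [mul_pow, Complex.cos_add_sin_mul_I_pow, ← Complex.ofReal_natCast m, ← Complex.ofReal_mul,
    ← Complex.ofReal_cos, ← Complex.ofReal_sin, ← Complex.ofReal_pow]
  apply Complex.ext <;>
    simp only [Complex.re_ofReal_mul, Complex.im_ofReal_mul, Complex.add_re, Complex.add_im,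
      Complex.ofReal_re, Complex.ofReal_im,
      Complex.I_re, Complex.I_im, mul_zero, mul_one, add_zero, zero_add]

/-- `ρ^|m| y_m(φ)` is a polynomial in the Cartesian coordinates of the plane. -/
lemma exists_mvPolynomial_ymfun (m : ℤ) :
    ∃ G : MvPolynomial (Fin 3) ℝ, G.totalDegree ≤ m.natAbs ∧
      ∀ x : E3, ‖(⟨x 0, x 1⟩ : ℂ)‖ ^ m.natAbs * ymfun m (sphPhi x)
        = MvPolynomial.eval (fun j => x j) G := by
  obtain ⟨A, B, hA, hB, h⟩ := exists_mvPolynomial_re_im_pow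
    (MvPolynomial.X (0 : Fin 3) : MvPolynomial (Fin 3) ℝ) (MvPolynomial.X 1)
    (MvPolynomial.totalDegree_X _).le (MvPolynomial.totalDegree_X _).le m.natAbs
  have hAB (x : E3) := (complex_pow_eq_norm_arg ⟨x 0, x 1⟩ m.natAbs).symm.trans
    (by simpa using h fun j => x j)
  have habs : ((m.natAbs : ℕ) : ℝ) = |(m : ℝ)| := by
    rw [← Int.cast_abs, Int.abs_eq_natAbs, Int.cast_natCast]
  rcases lt_trichotomy m 0 with hm | rfl | hm
  · refine ⟨B, hB, fun x => ?_⟩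
    have := congrArg Complex.im (hAB x)
    simpa [ymfun, hm.ne, hm.not_gt, sphPhi, habs] using this
  · exact ⟨MvPolynomial.C (1 / √2), by simp, fun x => by simp [ymfun]⟩
  · refine ⟨A, hA, fun x => ?_⟩
    have := congrArg Complex.re (hAB x)
    simpa [ymfun, hm.ne', hm, sphPhi, habs, abs_of_pos (Int.cast_pos.2 hm : (0 : ℝ) < m)] using this

lemma norm_sq_E3 (x : E3) : ‖x‖ ^ 2 = x 0 ^ 2 + x 1 ^ 2 + x 2 ^ 2 := by
  simp [EuclideanSpace.norm_sq_eq, Fin.sum_univ_three]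

lemma norm_mul_cos_sphTheta (x : E3) : ‖x‖ * Real.cos (sphTheta x) = x 2 := by
  have hle : |x 2| ≤ ‖x‖ := by simpa using PiLp.norm_apply_le x 2
  have hdiv : |x 2 / ‖x‖| ≤ 1 := by
    rw [abs_div, abs_norm]
    exact div_le_one_of_le₀ hle (norm_nonneg x)
  rw [sphTheta, Real.cos_arccos (abs_le.1 hdiv).1 (abs_le.1 hdiv).2]
  rcases eq_or_ne ‖x‖ 0 with h | h
  · rw [h] at hle ⊢
    rw [zero_mul, abs_nonpos_iff.1 hle]
  · field_simp

lemma norm_mul_sqrt_one_sub_cos_sphTheta_sq (x : E3) :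
    ‖x‖ * √(1 - Real.cos (sphTheta x) ^ 2) = ‖(⟨x 0, x 1⟩ : ℂ)‖ := by
  rw [← abs_norm x, ← Real.sqrt_sq_eq_abs, ← Real.sqrt_mul (sq_nonneg _), Complex.norm_def,
    Complex.normSq_apply]
  congr 1
  linear_combination norm_sq_E3 x - (‖x‖ * Real.cos (sphTheta x) + x 2) * norm_mul_cos_sphTheta x

lemma cos_sphChi (x : E3) : Real.cos (sphChi x) = 1 - 2 * (‖x‖ ^ 2 + 1)⁻¹ := by
  have hN : 0 < ‖x‖ ^ 2 + 1 := by positivity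
  rw [sphChi, Real.cos_arccos]
  · field_simp
    ring
  · rw [le_div_iff₀ hN]
    nlinarith [sq_nonneg ‖x‖]
  · rw [div_le_one hN]
    linarith

lemma sin_sphChi (x : E3) : Real.sin (sphChi x) = 2 * (‖x‖ ^ 2 + 1)⁻¹ * ‖x‖ := by
  have hsin : Real.sin (sphChi x) = √(1 - Real.cos (sphChi x) ^ 2) :=
    Real.sin_eq_sqrt_one_sub_cos_sq (Real.arccos_nonneg _) (Real.arccos_le_pi _)
  rw [hsin, cos_sphChi]
  rw [← Real.sqrt_sq (by positivity : 0 ≤ 2 * (‖x‖ ^ 2 + 1)⁻¹ * ‖x‖)]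
  congr 1
  field_simp
  ring

/-- The solid harmonic `|x|^ℓ Y_{ℓ,m}(x / |x|)` is a polynomial of degree at most `ℓ`. -/
lemma exists_mvPolynomial_Y2fun (l : ℕ) (m : ℤ) (hm : m.natAbs ≤ l) :
    ∃ H : MvPolynomial (Fin 3) ℝ, H.totalDegree ≤ l ∧
      ∀ x : E3, ‖x‖ ^ l * Y2fun l m (sphPhi x) (sphTheta x)
        = MvPolynomial.eval (fun j => x j) H := by
  obtain ⟨G, hG, hGe⟩ := exists_mvPolynomial_ymfun m
  have hX (i : Fin 3) : (MvPolynomial.X i ^ 2 : MvPolynomial (Fin 3) ℝ).totalDegree ≤ 2 := by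
    simp
  obtain ⟨H, hH, hHe⟩ := exists_mvPolynomial_eq_pow_mul_eval
    (Polynomial.derivative^[l + m.natAbs] ((Polynomial.X ^ 2 - 1 : Polynomial ℝ) ^ l))
    (l - m.natAbs)
    ((natDegree_iterate_derivative_X_sq_sub_one_pow_le _ _).trans (by omega))
    (fun j _ h => coeff_iterate_derivative_X_sq_sub_one_pow _ _ _ (by omega))
    (MvPolynomial.X (2 : Fin 3))
    (MvPolynomial.X 0 ^ 2 + MvPolynomial.X 1 ^ 2 + MvPolynomial.X 2 ^ 2)
    (MvPolynomial.totalDegree_X _).le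
    ((MvPolynomial.totalDegree_add _ _).trans
      (max_le ((MvPolynomial.totalDegree_add _ _).trans (max_le (hX 0) (hX 1))) (hX 2)))
  refine ⟨(√((2 * l + 1) / (2 * π)) * ((-1) ^ m.natAbs *
    √((Nat.factorial (l - m.natAbs)) / (Nat.factorial (l + m.natAbs))) *
      ((-1) ^ m.natAbs / (2 ^ l * (Nat.factorial l))))) • (G * H), ?_, fun x => ?_⟩
  · refine (MvPolynomial.totalDegree_smul_le _ _).trans
      ((MvPolynomial.totalDegree_mul _ _).trans ?_)
    omega
  · rw [MvPolynomial.smul_eval, map_mul, ← hGe x, ← norm_mul_sqrt_one_sub_cos_sphTheta_sq,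
      ← hHe (fun j => x j) ‖x‖ (Real.cos (sphTheta x)) (by simp [norm_mul_cos_sphTheta])
        (by simp [norm_sq_E3]), Y2fun, Kfun, legendreP]
    nth_rewrite 1 [← Nat.add_sub_of_le hm]
    rw [pow_add, mul_pow]
    ring

lemma natDegree_chebyshev_derivative_comp_le (k l : ℕ) :
    ((Polynomial.derivative^[l + 1] (Polynomial.Chebyshev.T ℝ ((k + 1 : ℕ) : ℤ))).comp
      (1 - 2 * Polynomial.X)).natDegree ≤ k - l := by
  refine Polynomial.natDegree_comp_le.trans ?_
  have h₁ := Polynomial.natDegree_iterate_derivative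
    (Polynomial.Chebyshev.T ℝ ((k + 1 : ℕ) : ℤ)) (l + 1)
  rw [Polynomial.Chebyshev.natDegree_T] at h₁
  have h₂ : (1 - 2 * Polynomial.X : Polynomial ℝ).natDegree ≤ 1 := by compute_degree
  have h₃ := Nat.mul_le_mul h₁ h₂
  simp only [Int.natAbs_natCast] at h₃
  omega

/-- For every `k ≥ 0` and `α ∈ Λ_k`, there exist `k+1` polynomials
`p₀, …, p_k`, with `deg p_i ≤ i`, such that `𝒲_α(x) = Σ_{i=0}^k p_i(x)/(|x|²+1)^{i+1/2}`. -/
theorem AB_rational_form (k : ℕ) (α : ℕ × ℕ × ℤ) (hα : memLam α) (hk : α.1 = k) :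
    ∃ p : ℕ → MvPolynomial (Fin 3) ℝ,
      (∀ i, i ≤ k → (p i).totalDegree ≤ i) ∧
      ∀ x : E3, Wfun α x
        = ∑ i ∈ Finset.range (k+1),
            (MvPolynomial.eval (fun j => x j) (p i)) / (‖x‖^2+1) ^ ((i:ℝ) + 1/2) := by
  obtain ⟨k', l, m⟩ := α
  obtain ⟨hl, hm⟩ := hα
  obtain rfl : k' = k := hk
  dsimp only at hl hm
  obtain ⟨H, hH, hHe⟩ := exists_mvPolynomial_Y2fun l m hm
  set P := (Polynomial.derivative^[l + 1] (Polynomial.Chebyshev.T ℝ ((k' + 1 : ℕ) : ℤ))).comp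
    (1 - 2 * Polynomial.X)
  refine ⟨fun i => if l ≤ i then
    MvPolynomial.C (√2 * (1 / √(akl k' l)) * 2 ^ l * P.coeff (i - l)) * H else 0, ?_, fun x => ?_⟩
  · intro i _
    dsimp only
    split_ifs with hi
    · refine (MvPolynomial.totalDegree_mul _ _).trans ?_
      rw [MvPolynomial.totalDegree_C]
      omega
    · simp
  · have hN : 0 < ‖x‖ ^ 2 + 1 := by positivity
    have hcheb : chebDeriv (k' + 1) (l + 1) (Real.cos (sphChi x))
        = ∑ i ∈ Finset.range (k' - l + 1), P.coeff i * (‖x‖ ^ 2 + 1)⁻¹ ^ i := by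
      rw [← Polynomial.eval_eq_sum_range'
        (Nat.lt_succ_of_le (natDegree_chebyshev_derivative_comp_le k' l)),
        Polynomial.eval_comp, chebDeriv, cos_sphChi]
      simp
    have hsplit : k' + 1 = l + (k' - l + 1) := by omega
    have hlow : ∀ i ∈ Finset.range l, MvPolynomial.eval (fun j => x j) (if l ≤ i then
        MvPolynomial.C (√2 * (1 / √(akl k' l)) * 2 ^ l * P.coeff (i - l)) * H else 0)
          / (‖x‖ ^ 2 + 1) ^ ((i : ℝ) + 1 / 2) = 0 := fun i hi => by
      rw [if_neg (not_le.2 (Finset.mem_range.1 hi)), map_zero, zero_div]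
    rw [hsplit, Finset.sum_range_add, Finset.sum_eq_zero hlow, zero_add, Wfun, Yfun]
    dsimp only
    rw [hcheb, sin_sphChi, Finset.mul_sum, Finset.sum_mul, Finset.mul_sum]
    refine Finset.sum_congr rfl fun i _ => ?_
    rw [if_pos (Nat.le_add_right l i), Nat.add_sub_cancel_left, map_mul, MvPolynomial.eval_C,
      ← hHe x, Real.rpow_add hN, Real.rpow_natCast, ← Real.sqrt_eq_rpow,
      Real.sqrt_div zero_le_two]
    have hs : √(‖x‖ ^ 2 + 1) ≠ 0 := (Real.sqrt_pos.2 hN).ne'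
    rw [mul_pow, mul_pow, inv_pow, inv_pow, pow_add]
    field_simp

end
end

section
/- For every integer k ≥ 0, every index α = (k,ℓ,m) ∈ Λ_k, and every β = (k',ℓ',m') ∈ Λ, the gradient orthogonality relation ∫_{ℝ³} ∇𝒲_α(x) · ∇𝒲_β(x) dx = ((2k+1)(2k+3)/4) δ_{αβ} holds, where δ_{αβ} = δ_{kk'} δ_{ℓℓ'} δ_{mm'} is the Kronecker symbol. -/
open MeasureTheory Real Filter Metric
open scoped RealInnerProductSpace BigOperators

noncomputable section

/-- `P` solves the ultraspherical equation `(1 - x²) P'' - (s + 1) x P' + b P = 0`. -/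
def IsUltraspherical (s : ℕ) (b : ℝ) (P : Polynomial ℝ) : Prop :=
  ∀ x : ℝ, (1 - x ^ 2) * P.derivative.derivative.eval x - (s + 1) * x * P.derivative.eval x
    + b * P.eval x = 0

/-- The weighted pairing `∫₀^π sin^s t P(cos t) V(cos t) dt`. -/
def sinPairing (s : ℕ) (P V : Polynomial ℝ) : ℝ :=
  ∫ t in (0)..π, sin t ^ s * (P.eval (cos t) * V.eval (cos t))

theorem sinPairing_comm (s : ℕ) (P V : Polynomial ℝ) : sinPairing s P V = sinPairing s V P := by
  simp only [sinPairing, mul_comm (P.eval _)]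

theorem hasDerivAt_eval_cos (P : Polynomial ℝ) (t : ℝ) :
    HasDerivAt (fun t => P.eval (cos t)) (-(sin t * P.derivative.eval (cos t))) t := by
  exact ((P.hasDerivAt (cos t)).comp t (hasDerivAt_cos t)).congr_deriv (by ring)

theorem hasDerivAt_sin_pow_succ (n : ℕ) (t : ℝ) :
    HasDerivAt (fun t => sin t ^ (n + 1)) ((n + 1) * sin t ^ n * cos t) t := by
  exact ((hasDerivAt_sin t).fun_pow (n + 1)).congr_deriv (by simp)

theorem IsUltraspherical.sinPairing_derivative {s : ℕ} {b : ℝ} {P : Polynomial ℝ}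
    (hP : IsUltraspherical s b P) (V : Polynomial ℝ) :
    sinPairing (s + 2) P.derivative V.derivative = b * sinPairing s P V := by
  have hder : ∀ t : ℝ, HasDerivAt
      (fun t => sin t ^ (s + 1) * (P.derivative.eval (cos t) * V.eval (cos t)))
      (b * (sin t ^ s * (P.eval (cos t) * V.eval (cos t)))
        - sin t ^ (s + 2) * (P.derivative.eval (cos t) * V.derivative.eval (cos t))) t := by
    intro t
    refine ((hasDerivAt_sin_pow_succ s t).fun_mul
      ((hasDerivAt_eval_cos P.derivative t).fun_mul (hasDerivAt_eval_cos V t))).congr_deriv ?_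
    linear_combination -(sin t ^ s * V.eval (cos t)) * hP (cos t)
      - sin t ^ s * V.eval (cos t) * P.derivative.derivative.eval (cos t) * sin_sq_add_cos_sq t
  have h := intervalIntegral.integral_eq_sub_of_hasDerivAt (a := 0) (b := π)
    (fun t _ => hder t) (Continuous.intervalIntegrable (by fun_prop) _ _)
  rw [intervalIntegral.integral_sub (Continuous.intervalIntegrable (by fun_prop) _ _)
    (Continuous.intervalIntegrable (by fun_prop) _ _), intervalIntegral.integral_const_mul] at h
  simp only [sin_pi, sin_zero, ne_eq, Nat.add_eq_zero_iff, one_ne_zero, and_false,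
    not_false_eq_true, zero_pow, zero_mul, sub_self] at h
  simp only [sinPairing]
  linarith

theorem IsUltraspherical.sinPairing_eq_zero {s : ℕ} {b c : ℝ} {P V : Polynomial ℝ}
    (hP : IsUltraspherical s b P) (hV : IsUltraspherical s c V) (hbc : b ≠ c) :
    sinPairing s P V = 0 := by
  have h := hP.sinPairing_derivative V
  rw [sinPairing_comm, hV.sinPairing_derivative P, sinPairing_comm] at h
  have : (b - c) * sinPairing s P V = 0 := by linarith
  exact (mul_eq_zero.1 this).resolve_left (sub_ne_zero.2 hbc)

/-- The Sturm–Liouville profile `sin^m t P(cos t)`. -/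
def profile (m : ℕ) (P : Polynomial ℝ) (t : ℝ) : ℝ := sin t ^ m * P.eval (cos t)

/-- The derivative of `profile m P`. -/
def profileDeriv (m : ℕ) (P : Polynomial ℝ) (t : ℝ) : ℝ :=
  m * sin t ^ (m - 1) * cos t * P.eval (cos t) - sin t ^ (m + 1) * P.derivative.eval (cos t)

theorem hasDerivAt_profile (m : ℕ) (P : Polynomial ℝ) (t : ℝ) :
    HasDerivAt (profile m P) (profileDeriv m P t) t := by
  refine (((hasDerivAt_sin t).fun_pow m).fun_mul (hasDerivAt_eval_cos P t)).congr_deriv ?_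
  simp only [profileDeriv]
  ring

@[fun_prop]
theorem continuous_profile (m : ℕ) (P : Polynomial ℝ) : Continuous (profile m P) := by
  unfold profile; fun_prop

@[fun_prop]
theorem continuous_profileDeriv (m : ℕ) (P : Polynomial ℝ) : Continuous (profileDeriv m P) := by
  unfold profileDeriv; fun_prop

theorem integral_profile_mul_sin (m d : ℕ) (P V : Polynomial ℝ) :
    ∫ t in (0)..π, profile m P t * profile m V t * sin t ^ d = sinPairing (2 * m + d) P V := by
  refine intervalIntegral.integral_congr fun t _ => ?_
  simp only [profile]
  ring

theorem sin_mul_profileDeriv (m : ℕ) (P : Polynomial ℝ) (t : ℝ) :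
    sin t * profileDeriv m P t
      = m * sin t ^ m * cos t * P.eval (cos t) - sin t ^ (m + 2) * P.derivative.eval (cos t) := by
  rcases m with _ | m
  · simp [profileDeriv]; ring
  · simp [profileDeriv]; ring

theorem hasDerivAt_sin_mul_profileDeriv (m : ℕ) (P : Polynomial ℝ) (t : ℝ) :
    HasDerivAt (fun t => sin t * profileDeriv m P t)
      (m ^ 2 * sin t ^ (m - 1) * cos t ^ 2 * P.eval (cos t) - m * sin t ^ (m + 1) * P.eval (cos t)
        - (2 * m + 2) * sin t ^ (m + 1) * cos t * P.derivative.eval (cos t)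
        + sin t ^ (m + 3) * P.derivative.derivative.eval (cos t)) t := by
  simp only [sin_mul_profileDeriv]
  refine ((((((hasDerivAt_sin t).fun_pow m).const_mul (m : ℝ)).fun_mul (hasDerivAt_cos t)).fun_mul
    (hasDerivAt_eval_cos P t)).fun_sub ((hasDerivAt_sin_pow_succ (m + 1) t).fun_mul
    (hasDerivAt_eval_cos P.derivative t))).congr_deriv ?_
  push_cast
  ring

theorem IsUltraspherical.integral_polar_form {m : ℕ} {b : ℝ} {P : Polynomial ℝ}
    (hP : IsUltraspherical (2 * m + 1) b P) (V : Polynomial ℝ) :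
    (∫ t in (0)..π, (profileDeriv m P t * profileDeriv m V t * sin t
      + m ^ 2 * (sin t ^ (m + m - 1) * (P.eval (cos t) * V.eval (cos t)))))
      = (b + m * (m + 1)) * sinPairing (2 * m + 1) P V := by
  have hder : ∀ t : ℝ, HasDerivAt (fun t => sin t * profileDeriv m P t * profile m V t)
      ((profileDeriv m P t * profileDeriv m V t * sin t
        + m ^ 2 * (sin t ^ (m + m - 1) * (P.eval (cos t) * V.eval (cos t))))
        - (b + m * (m + 1)) * (sin t ^ (2 * m + 1) * (P.eval (cos t) * V.eval (cos t)))) t := by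
    intro t
    refine ((hasDerivAt_sin_mul_profileDeriv m P t).fun_mul (hasDerivAt_profile m V t)).congr_deriv ?_
    · have ode := hP (cos t)
      have sc := sin_sq_add_cos_sq t
      simp only [profileDeriv, profile]
      rcases m with _ | m
      · simp at ode ⊢
        linear_combination sin t * V.eval (cos t) * ode
          + sin t * V.eval (cos t) * P.derivative.derivative.eval (cos t) * sc
      · have e : m + 1 + (m + 1) - 1 = 2 * m + 1 := by omega
        rw [e]
        push_cast at ode ⊢
        linear_combination sin t ^ (2 * m + 3) * V.eval (cos t) * ode
          + sin t ^ (2 * m + 3) * V.eval (cos t) * P.derivative.derivative.eval (cos t) * sc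
          + (m + 1) ^ 2 * sin t ^ (2 * m + 1) * P.eval (cos t) * V.eval (cos t) * sc
  have h := intervalIntegral.integral_eq_sub_of_hasDerivAt (a := 0) (b := π)
    (fun t _ => hder t) (Continuous.intervalIntegrable (by fun_prop) _ _)
  rw [intervalIntegral.integral_sub (Continuous.intervalIntegrable (by fun_prop) _ _)
    (Continuous.intervalIntegrable (by fun_prop) _ _), intervalIntegral.integral_const_mul] at h
  simp only [sin_pi, sin_zero, zero_mul, sub_self] at h
  simp only [sinPairing]
  linarith

/-- `½ (1 + cos t) u + sin t u'`, where `u = profile l P`: up to a factor, the radial derivative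
of `√(1 - cos t) u` in the stereographic coordinate. -/
def stereoDeriv (l : ℕ) (P : Polynomial ℝ) (t : ℝ) : ℝ :=
  (1 + cos t) / 2 * profile l P t + sin t * profileDeriv l P t

@[fun_prop]
theorem continuous_stereoDeriv (m : ℕ) (P : Polynomial ℝ) : Continuous (stereoDeriv m P) := by
  unfold stereoDeriv; fun_prop

theorem IsUltraspherical.integral_radial_form {l : ℕ} {b : ℝ} {P : Polynomial ℝ}
    (hP : IsUltraspherical (2 * l + 2) b P) (V : Polynomial ℝ) :
    (∫ t in (0)..π, (stereoDeriv l P t * stereoDeriv l V t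
      + l * (l + 1) * (profile l P t * profile l V t)))
      = (b + l * (l + 2) + 3 / 4) * sinPairing (2 * l + 2) P V := by
  have hder : ∀ t : ℝ, HasDerivAt
      (fun t => sin t * stereoDeriv l P t * profile l V t)
      ((stereoDeriv l P t * stereoDeriv l V t + l * (l + 1) * (profile l P t * profile l V t))
        - (b + l * (l + 2) + 3 / 4) *
          (sin t ^ (2 * l + 2) * (P.eval (cos t) * V.eval (cos t)))) t := by
    intro t
    refine (((hasDerivAt_sin t).fun_mul (((((hasDerivAt_cos t).const_add 1).div_const 2).fun_mul
      (hasDerivAt_profile l P t)).fun_add (hasDerivAt_sin_mul_profileDeriv l P t))).fun_mul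
      (hasDerivAt_profile l V t)).congr_deriv ?_
    · have ode := hP (cos t)
      have sc := sin_sq_add_cos_sq t
      simp only [stereoDeriv, profileDeriv, profile]
      rcases l with _ | m
      · simp at ode ⊢
        linear_combination sin t ^ 2 * V.eval (cos t) * ode
          + sin t ^ 2 * V.eval (cos t) * P.derivative.derivative.eval (cos t) * sc
          + 1 / 4 * P.eval (cos t) * V.eval (cos t) * sc
      · push_cast at ode ⊢
        linear_combination sin t ^ (2 * m + 4) * V.eval (cos t) * ode
          + sin t ^ (2 * m + 4) * V.eval (cos t) * P.derivative.derivative.eval (cos t) * sc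
          + (m ^ 2 + 3 * m + 9 / 4) * sin t ^ (2 * m + 2) * P.eval (cos t) * V.eval (cos t) * sc
  have h := intervalIntegral.integral_eq_sub_of_hasDerivAt (a := 0) (b := π)
    (fun t _ => hder t) (Continuous.intervalIntegrable (by fun_prop) _ _)
  rw [intervalIntegral.integral_sub (Continuous.intervalIntegrable (by fun_prop) _ _)
    (Continuous.intervalIntegrable (by fun_prop) _ _), intervalIntegral.integral_const_mul] at h
  simp only [sin_pi, sin_zero, zero_mul, sub_self] at h
  simp only [sinPairing]
  linarith

open Polynomial in
theorem isUltraspherical_iterate_derivative_T (n : ℤ) (j : ℕ) :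
    IsUltraspherical (2 * j) (n ^ 2 - j ^ 2) (derivative^[j] (Chebyshev.T ℝ n)) := by
  intro x
  have h := Chebyshev.one_sub_X_sq_mul_iterate_derivative_T_eval n j x
  rw [Function.iterate_succ_apply', Function.iterate_succ_apply'] at h
  push_cast
  linear_combination h

open Polynomial in
theorem sinPairing_iterate_derivative_T (k j : ℕ) (hj : j ≤ k + 1) :
    sinPairing (2 * j) (derivative^[j] (Chebyshev.T ℝ ((k + 1 : ℕ) : ℤ)))
      (derivative^[j] (Chebyshev.T ℝ ((k + 1 : ℕ) : ℤ))) * (k + 1 - j).factorial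
      = (k + 1) * π / 2 * (k + j).factorial := by
  induction j with
  | zero =>
    have hcos_int : ∫ t in (0)..π, cos (((k + 1 : ℕ) : ℝ) * t) ^ 2 = π / 2 := by
      have hk : ((k + 1 : ℕ) : ℝ) ≠ 0 := by positivity
      rw [intervalIntegral.integral_comp_mul_left (fun t => cos t ^ 2) hk, integral_cos_sq]
      simp only [mul_zero, sin_zero, sin_nat_mul_pi, smul_eq_mul]
      field_simp
      ring
    simp only [sinPairing, Function.iterate_zero, id, Chebyshev.T_real_cos, mul_zero, pow_zero,
      one_mul, ← sq]
    push_cast at hcos_int ⊢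
    rw [hcos_int, Nat.add_zero, Nat.factorial_succ]
    push_cast
    ring_nf
  | succ j ih =>
    have h := (isUltraspherical_iterate_derivative_T ((k + 1 : ℕ) : ℤ) j).sinPairing_derivative
      (derivative^[j] (Chebyshev.T ℝ ((k + 1 : ℕ) : ℤ)))
    obtain ⟨i, rfl⟩ : ∃ i, k = j + i := ⟨k - j, by omega⟩
    have ih := ih (by omega)
    rw [show j + i + 1 - j = i + 1 by omega, Nat.factorial_succ] at ih
    rw [Function.iterate_succ_apply', mul_add, mul_one, h, show j + i + 1 - (j + 1) = i by omega,
      show j + i + (j + 1) = (j + i + j) + 1 by omega, Nat.factorial_succ]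
    push_cast at ih ⊢
    linear_combination (j + i + j + 1) * ih

/-- The unnormalised Legendre-type polynomial `(d/dx)^{l+m} (x² - 1)^l`. -/
def rodrigues (l m : ℕ) : Polynomial ℝ :=
  Polynomial.derivative^[l + m] ((Polynomial.X ^ 2 - 1) ^ l)

theorem rodrigues_succ (l m : ℕ) : rodrigues l (m + 1) = (rodrigues l m).derivative := by
  rw [rodrigues, ← add_assoc, Function.iterate_succ_apply']; rfl

open Polynomial in
theorem iterate_derivative_X_sq_sub_one_pow_ode (l j : ℕ) :
    (1 - X ^ 2) * derivative^[j + 2] ((X ^ 2 - 1 : ℝ[X]) ^ l)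
      - (2 - 2 * (l : ℝ[X]) + 2 * (j : ℝ[X])) * X * derivative^[j + 1] ((X ^ 2 - 1 : ℝ[X]) ^ l)
      + (2 * (l : ℝ[X]) - (j : ℝ[X]) * (2 - 2 * (l : ℝ[X])) - (j : ℝ[X]) * ((j : ℝ[X]) - 1))
        * derivative^[j] ((X ^ 2 - 1 : ℝ[X]) ^ l)
      = 0 := by
  induction j with
  | zero =>
    have h : (1 - X ^ 2) * derivative ((X ^ 2 - 1 : ℝ[X]) ^ l)
        + 2 * (l : ℝ[X]) * X * (X ^ 2 - 1 : ℝ[X]) ^ l = 0 := by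
      rcases l with _ | l
      · simp
      · simp [derivative_pow, map_ofNat]; ring
    have h' := congrArg derivative h
    simp only [derivative_add, derivative_mul, derivative_sub, derivative_one, derivative_X_pow,
      derivative_X, derivative_natCast, derivative_ofNat, derivative_zero] at h'
    simp only [Function.iterate_succ_apply', Function.iterate_zero, id, Nat.cast_zero,
      Nat.cast_ofNat, map_ofNat] at h' ⊢
    linear_combination h'
  | succ j ih =>
    have h' := congrArg derivative ih
    simp only [derivative_add, derivative_mul, derivative_sub, derivative_one, derivative_X_pow,
      derivative_X, derivative_natCast, derivative_ofNat, derivative_zero,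
      ← Function.iterate_succ_apply' (⇑derivative)] at h'
    simp only [Nat.cast_ofNat, map_ofNat] at h'
    push_cast
    linear_combination h'

theorem isUltraspherical_rodrigues (l m : ℕ) :
    IsUltraspherical (2 * m + 1) (l * (l + 1) - m * (m + 1)) (rodrigues l m) := by
  intro x
  have h := congrArg (Polynomial.eval x) (iterate_derivative_X_sq_sub_one_pow_ode l (l + m))
  rw [rodrigues, ← Function.iterate_succ_apply' (⇑Polynomial.derivative),
    ← Function.iterate_succ_apply' (⇑Polynomial.derivative)]
  simp at h ⊢
  linear_combination h

theorem rodrigues_self (l : ℕ) : rodrigues l l = Polynomial.C ((2 * l).factorial : ℝ) := by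
  have hm : ((Polynomial.X ^ 2 - 1 : Polynomial ℝ) ^ l).Monic :=
    (Polynomial.monic_X_pow_sub_C 1 two_ne_zero).pow l
  have hd : ((Polynomial.X ^ 2 - 1 : Polynomial ℝ) ^ l).natDegree = 2 * l := by
    rw [Polynomial.natDegree_pow, ← Polynomial.C_1, Polynomial.natDegree_X_pow_sub_C, mul_comm]
  ext i
  rw [rodrigues, ← two_mul, Polynomial.coeff_iterate_derivative, Polynomial.coeff_C]
  split_ifs with h
  · subst h
    rw [zero_add, ← hd, Polynomial.coeff_natDegree, hm.leadingCoeff, Nat.descFactorial_self]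
    simp
  · rw [Polynomial.coeff_eq_zero_of_natDegree_lt (by omega), smul_zero]

theorem integral_sin_pow_odd_mul_factorial (l : ℕ) :
    (∫ x in (0)..π, sin x ^ (2 * l + 1)) * (2 * l + 1).factorial
      = 2 * (2 ^ l * l.factorial) ^ 2 := by
  rw [integral_sin_pow_odd]
  induction l with
  | zero => simp
  | succ l ih =>
    rw [Finset.prod_range_succ, show 2 * (l + 1) + 1 = (2 * l + 1) + 1 + 1 by ring,
      Nat.factorial_succ (2 * l + 1 + 1), Nat.factorial_succ (2 * l + 1), Nat.factorial_succ l]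
    push_cast
    have h3 : (2 * (l : ℝ) + 2) / (2 * l + 3) * (2 * l + 1 + 1 + 1) = 2 * l + 2 := by
      field_simp
      ring
    linear_combination (2 * (l : ℝ) + 2) ^ 2 * ih
      + (2 * ∏ i ∈ Finset.range l, (2 * (i : ℝ) + 2) / (2 * i + 3)) * (2 * l + 2)
        * (2 * l + 1).factorial * h3

theorem sinPairing_rodrigues (l m : ℕ) (hm : m ≤ l) :
    sinPairing (2 * m + 1) (rodrigues l m) (rodrigues l m) * ((2 * l + 1) * (l - m).factorial)
      = 2 * (l + m).factorial * (2 ^ l * l.factorial) ^ 2 := by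
  obtain ⟨i, rfl⟩ : ∃ i, l = m + i := ⟨l - m, by omega⟩
  induction i generalizing m with
  | zero =>
    have h := integral_sin_pow_odd_mul_factorial m
    rw [Nat.factorial_succ] at h
    simp only [sinPairing, add_zero, rodrigues_self, Polynomial.eval_C, Nat.sub_self,
      Nat.factorial_zero, intervalIntegral.integral_mul_const, ← two_mul]
    push_cast at h ⊢
    linear_combination (2 * m).factorial * h
  | succ i ih =>
    have h := (isUltraspherical_rodrigues (m + (i + 1)) m).sinPairing_derivative
      (rodrigues (m + (i + 1)) m)
    have ih := ih (m + 1) (by omega)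
    rw [show m + 1 + i = m + (i + 1) by ring] at ih
    rw [← rodrigues_succ, show 2 * m + 1 + 2 = 2 * (m + 1) + 1 by ring] at h
    rw [h, show m + (i + 1) - (m + 1) = i by omega,
      show m + (i + 1) + (m + 1) = (m + (i + 1) + m) + 1 by ring, Nat.factorial_succ] at ih
    rw [show m + (i + 1) - m = i + 1 by omega, Nat.factorial_succ]
    have hne : (m + (i + 1) + m + 1 : ℝ) ≠ 0 := by positivity
    refine mul_left_cancel₀ hne ?_
    push_cast at ih ⊢
    linear_combination ih

theorem hasDerivAt_ymfun (m : ℤ) (t : ℝ) : HasDerivAt (ymfun m) (-m * ymfun (-m) t) t := by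
  rcases lt_trichotomy m 0 with h | rfl | h
  · have e : ymfun m = fun t => sin (|(m : ℝ)| * t) := by
      ext t; simp [ymfun, h.ne, h.not_gt]
    rw [e]
    refine ((hasDerivAt_sin _).comp t ((hasDerivAt_id t).const_mul _)).congr_deriv ?_
    have : (m : ℝ) < 0 := by exact_mod_cast h
    simp [ymfun, h.ne, h, abs_of_neg this]
    ring
  · have e : ymfun 0 = fun t => 1 / √2 := by ext t; simp [ymfun]
    rw [e]; simpa using hasDerivAt_const t (1 / √2)
  · have e : ymfun m = fun t => cos (m * t) := by
      ext t; simp [ymfun, h.ne', h]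
    rw [e]
    refine ((hasDerivAt_cos _).comp t ((hasDerivAt_id t).const_mul _)).congr_deriv ?_
    have : 0 < (m : ℝ) := by exact_mod_cast h
    simp [ymfun, h.ne', h.not_gt, abs_of_pos this]
    ring

@[fun_prop]
theorem continuous_ymfun (m : ℤ) : Continuous (ymfun m) :=
  continuous_iff_continuousAt.2 fun t => (hasDerivAt_ymfun m t).continuousAt

theorem ymfun_neg_pi (m : ℤ) : ymfun m (-π) = ymfun m π := by
  have h : ∀ n : ℤ, sin (n * π) = 0 := sin_int_mul_pi
  unfold ymfun
  split_ifs
  · rfl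
  · simp
  · have := h |m|
    push_cast at this
    simp [this]

theorem ymfun_sq_add_sq (m : ℤ) (t : ℝ) : ymfun m t ^ 2 + ymfun (-m) t ^ 2 = 1 := by
  rcases lt_trichotomy m 0 with h | rfl | h
  · have : (m : ℝ) < 0 := by exact_mod_cast h
    simp [ymfun, h.ne, h, h.not_gt, abs_of_neg this]
  · simp [ymfun]; norm_num
  · have : 0 < (m : ℝ) := by exact_mod_cast h
    simp [ymfun, h.ne', h, h.not_gt, abs_of_pos this]

theorem integral_eq_zero_of_hasDerivAt_of_eq {f f' : ℝ → ℝ} {a b : ℝ}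
    (hf : ∀ t, HasDerivAt f (f' t) t) (hc : Continuous f') (hp : f a = f b) :
    ∫ t in a..b, f' t = 0 := by
  rw [intervalIntegral.integral_eq_sub_of_hasDerivAt (fun t _ => hf t)
    (hc.intervalIntegrable _ _), hp, sub_self]

theorem integral_ymfun_mul (m n : ℤ) :
    ∫ t in (-π)..π, ymfun m t * ymfun n t = if m = n then π else 0 := by
  have hd : ∀ (p : ℤ) (t : ℝ), HasDerivAt (ymfun p) (-p * ymfun (-p) t) t := hasDerivAt_ymfun
  have hd' : ∀ (p : ℤ) (t : ℝ), HasDerivAt (ymfun (-p)) (p * ymfun p t) t := fun p t => by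
    simpa using hasDerivAt_ymfun (-p) t
  have h_int : ∀ p q : ℤ, IntervalIntegrable (fun t => ymfun p t * ymfun q t) volume (-π) π :=
    fun p q => Continuous.intervalIntegrable (by fun_prop) _ _
  by_cases h2 : m ^ 2 = n ^ 2
  · rcases sq_eq_sq_iff_eq_or_eq_neg.1 h2 with rfl | rfl
    · have hsum : (∫ t in (-π)..π, ymfun m t * ymfun m t)
          + ∫ t in (-π)..π, ymfun (-m) t * ymfun (-m) t = 2 * π := by
        rw [← intervalIntegral.integral_add (h_int _ _) (h_int _ _)]
        simp only [← sq, ymfun_sq_add_sq, intervalIntegral.integral_const, smul_eq_mul]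
        ring
      have hdiff : (m : ℝ) * ((∫ t in (-π)..π, ymfun m t * ymfun m t)
          - ∫ t in (-π)..π, ymfun (-m) t * ymfun (-m) t) = 0 := by
        rw [← intervalIntegral.integral_sub (h_int _ _) (h_int _ _),
          ← intervalIntegral.integral_const_mul]
        refine integral_eq_zero_of_hasDerivAt_of_eq (f := fun t => ymfun m t * ymfun (-m) t)
          (fun t => ((hd m t).fun_mul (hd' m t)).congr_deriv (by ring)) (by fun_prop) ?_
        simp only [ymfun_neg_pi]
      rw [if_pos rfl]
      rcases mul_eq_zero.1 hdiff with h0 | h0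
      · obtain rfl : m = 0 := by exact_mod_cast h0
        simp only [neg_zero] at hsum
        linarith
      · linarith
    · have h0 : (n : ℝ) * ∫ t in (-π)..π, ymfun (-n) t * ymfun n t = 0 := by
        rw [← intervalIntegral.integral_const_mul]
        refine integral_eq_zero_of_hasDerivAt_of_eq (f := fun t => -(ymfun n t ^ 2 / 2))
          (fun t => (((hd n t).fun_pow 2).div_const 2).fun_neg.congr_deriv (by simp; ring))
          (by fun_prop) ?_
        simp only [ymfun_neg_pi]
      rcases eq_or_ne n 0 with rfl | hn
      · have := ymfun_sq_add_sq 0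
        simp only [neg_zero, ← two_mul] at this
        have e : ∀ t, ymfun 0 t * ymfun 0 t = 1 / 2 := fun t => by linarith [this t]
        simp only [neg_zero, e, intervalIntegral.integral_const, smul_eq_mul]
        simp; ring
      · rw [if_neg (by omega)]
        exact (mul_eq_zero.1 h0).resolve_left (by exact_mod_cast hn)
  · rw [if_neg (by rintro rfl; exact h2 rfl)]
    have h0 : ((n : ℝ) ^ 2 - m ^ 2) * ∫ t in (-π)..π, ymfun m t * ymfun n t = 0 := by
      rw [← intervalIntegral.integral_const_mul]
      refine integral_eq_zero_of_hasDerivAt_of_eq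
        (f := fun t => -m * ymfun (-m) t * ymfun n t + n * ymfun m t * ymfun (-n) t)
        (fun t => ((((hd' m t).const_mul (-m : ℝ)).fun_mul (hd n t)).fun_add
          (((hd m t).const_mul (n : ℝ)).fun_mul (hd' n t))).congr_deriv (by ring))
        (by fun_prop) ?_
      simp only [ymfun_neg_pi]
    refine (mul_eq_zero.1 h0).resolve_left (sub_ne_zero.2 ?_)
    intro h
    exact h2 (by exact_mod_cast h.symm)

/-- Distance to the origin of the stereographic projection of a point at angle `t` from the
north pole of the sphere. -/
def stereoRadius (t : ℝ) : ℝ := sin t / (1 - cos t)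

theorem one_sub_cos_pos {t : ℝ} (ht : t ∈ Set.Ioo 0 π) : 0 < 1 - cos t := by
  have := cos_lt_cos_of_nonneg_of_le_pi le_rfl ht.2.le ht.1
  rw [cos_zero] at this
  linarith

theorem stereoRadius_pos {t : ℝ} (ht : t ∈ Set.Ioo 0 π) : 0 < stereoRadius t :=
  div_pos (sin_pos_of_mem_Ioo ht) (one_sub_cos_pos ht)

theorem stereoRadius_sq_add_one {t : ℝ} (ht : t ∈ Set.Ioo 0 π) :
    stereoRadius t ^ 2 + 1 = 2 / (1 - cos t) := by
  have h := (one_sub_cos_pos ht).ne'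
  rw [stereoRadius]
  field_simp
  rw [sin_sq]
  ring

theorem hasDerivAt_stereoRadius {t : ℝ} (ht : t ∈ Set.Ioo 0 π) :
    HasDerivAt stereoRadius (-1 / (1 - cos t)) t := by
  have h := (one_sub_cos_pos ht).ne'
  refine ((hasDerivAt_sin t).fun_div ((hasDerivAt_cos t).const_sub 1) h).congr_deriv ?_
  rw [div_eq_div_iff (pow_ne_zero 2 h) h]
  linear_combination (1 - cos t) * (-1) * sin_sq_add_cos_sq t

/-- The box of spherical coordinates `(χ, θ, φ)`. -/
def coordBox : Set (Fin 3 → ℝ) := Set.univ.pi fun i => Set.Ioo (![0, 0, -π] i) π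

theorem mem_coordBox {p : Fin 3 → ℝ} :
    p ∈ coordBox ↔ p 0 ∈ Set.Ioo 0 π ∧ p 1 ∈ Set.Ioo 0 π ∧ p 2 ∈ Set.Ioo (-π) π := by
  simp [coordBox, Fin.forall_fin_succ]

theorem isOpen_coordBox : IsOpen coordBox :=
  isOpen_set_pi Set.finite_univ fun _ _ => isOpen_Ioo

/-- The point of space whose image in the sphere has the spherical coordinates `(χ, θ, φ)`. -/
def stereoPoint (p : Fin 3 → ℝ) : Fin 3 → ℝ :=
  ![stereoRadius (p 0) * (sin (p 1) * cos (p 2)), stereoRadius (p 0) * (sin (p 1) * sin (p 2)),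
    stereoRadius (p 0) * cos (p 1)]

/-- The Jacobian matrix of `stereoPoint`. -/
def stereoJacobian (p : Fin 3 → ℝ) : Matrix (Fin 3) (Fin 3) ℝ :=
  !![-1 / (1 - cos (p 0)) * (sin (p 1) * cos (p 2)),
      stereoRadius (p 0) * (cos (p 1) * cos (p 2)),
      -(stereoRadius (p 0) * (sin (p 1) * sin (p 2)));
    -1 / (1 - cos (p 0)) * (sin (p 1) * sin (p 2)),
      stereoRadius (p 0) * (cos (p 1) * sin (p 2)),
      stereoRadius (p 0) * (sin (p 1) * cos (p 2));
    -1 / (1 - cos (p 0)) * cos (p 1), -(stereoRadius (p 0) * sin (p 1)), 0]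

theorem det_stereoJacobian (p : Fin 3 → ℝ) :
    (stereoJacobian p).det
      = -(1 / (1 - cos (p 0)) * stereoRadius (p 0) ^ 2 * sin (p 1)) := by
  rw [stereoJacobian, Matrix.det_fin_three]
  simp only [Matrix.of_apply, Matrix.cons_val]
  have h1 := sin_sq_add_cos_sq (p 1)
  have h2 := sin_sq_add_cos_sq (p 2)
  linear_combination (-1 / (1 - cos (p 0)) * stereoRadius (p 0) ^ 2 * sin (p 1)) *
    (h1 + (sin (p 1) ^ 2 + cos (p 1) ^ 2) * h2)

theorem hasFDerivAt_stereoPoint {p : Fin 3 → ℝ} (hp : p ∈ coordBox) :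
    HasFDerivAt stereoPoint (Matrix.toLin' (stereoJacobian p)).toContinuousLinearMap p := by
  have hr := (hasDerivAt_stereoRadius (mem_coordBox.1 hp).1).comp_hasFDerivAt p
    (hasFDerivAt_apply (𝕜 := ℝ) (0 : Fin 3) p)
  have hs := fun i => (hasDerivAt_sin (p i)).comp_hasFDerivAt p
    (hasFDerivAt_apply (𝕜 := ℝ) (i : Fin 3) p)
  have hc := fun i => (hasDerivAt_cos (p i)).comp_hasFDerivAt p
    (hasFDerivAt_apply (𝕜 := ℝ) (i : Fin 3) p)
  refine hasFDerivAt_pi'.2 fun i => ?_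
  fin_cases i
  · refine (hr.mul ((hs 1).mul (hc 2))).congr_fderiv ?_
    ext v
    simp [stereoJacobian, dotProduct, Fin.sum_univ_succ]
    ring
  · refine (hr.mul ((hs 1).mul (hs 2))).congr_fderiv ?_
    ext v
    simp [stereoJacobian, dotProduct, Fin.sum_univ_succ]
    ring
  · refine (hr.mul (hc 1)).congr_fderiv ?_
    ext v
    simp [stereoJacobian, dotProduct, Fin.sum_univ_succ]
    ring

theorem norm_stereoPoint {p : Fin 3 → ℝ} (hp : p ∈ coordBox) :
    ‖(WithLp.toLp 2 (stereoPoint p) : E3)‖ = stereoRadius (p 0) := by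
  rw [EuclideanSpace.norm_eq, sqrt_eq_iff_mul_self_eq_of_pos (stereoRadius_pos (mem_coordBox.1 hp).1)]
  simp only [stereoPoint, Fin.sum_univ_three, norm_eq_abs, sq_abs, Matrix.cons_val]
  have h1 := sin_sq_add_cos_sq (p 1)
  have h2 := sin_sq_add_cos_sq (p 2)
  linear_combination -stereoRadius (p 0) ^ 2 * (h1 + sin (p 1) ^ 2 * h2)

theorem sphPhi_stereoPoint {p : Fin 3 → ℝ} (hp : p ∈ coordBox) :
    sphPhi (WithLp.toLp 2 (stereoPoint p)) = p 2 := by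
  obtain ⟨h0, h1, h2⟩ := mem_coordBox.1 hp
  have h : (⟨stereoPoint p 0, stereoPoint p 1⟩ : ℂ)
      = ((stereoRadius (p 0) * sin (p 1) : ℝ) : ℂ) *
          (Complex.cos (p 2) + Complex.sin (p 2) * Complex.I) := by
    apply Complex.ext <;> simp [stereoPoint, ← Complex.ofReal_cos, ← Complex.ofReal_sin, mul_assoc]
  exact (congrArg Complex.arg h).trans (Complex.arg_mul_cos_add_sin_mul_I
    (mul_pos (stereoRadius_pos h0) (sin_pos_of_mem_Ioo h1)) ⟨h2.1, h2.2.le⟩)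

theorem cos_sphTheta_stereoPoint {p : Fin 3 → ℝ} (hp : p ∈ coordBox) :
    stereoPoint p 2 / ‖(WithLp.toLp 2 (stereoPoint p) : E3)‖ = cos (p 1) := by
  rw [norm_stereoPoint hp]
  exact mul_div_cancel_left₀ _ (stereoRadius_pos (mem_coordBox.1 hp).1).ne'

theorem sphTheta_stereoPoint {p : Fin 3 → ℝ} (hp : p ∈ coordBox) :
    sphTheta (WithLp.toLp 2 (stereoPoint p)) = p 1 := by
  obtain ⟨h0, h1, h2⟩ := mem_coordBox.1 hp
  exact (congrArg arccos (cos_sphTheta_stereoPoint hp)).trans (arccos_cos h1.1.le h1.2.le)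

theorem stereoRadius_sq_sub_one_div {t : ℝ} (ht : t ∈ Set.Ioo 0 π) :
    (stereoRadius t ^ 2 - 1) / (stereoRadius t ^ 2 + 1) = cos t := by
  have h := one_sub_cos_pos ht
  rw [show stereoRadius t ^ 2 - 1 = stereoRadius t ^ 2 + 1 - 2 by ring,
    stereoRadius_sq_add_one ht]
  field_simp
  ring

theorem sphChi_stereoPoint {p : Fin 3 → ℝ} (hp : p ∈ coordBox) :
    sphChi (WithLp.toLp 2 (stereoPoint p)) = p 0 := by
  obtain ⟨h0, h1, h2⟩ := mem_coordBox.1 hp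
  rw [sphChi, norm_stereoPoint hp, stereoRadius_sq_sub_one_div h0, arccos_cos h0.1.le h0.2.le]

theorem injOn_stereoPoint : Set.InjOn stereoPoint coordBox := by
  intro p hp q hq h
  have e := congrArg (WithLp.toLp 2) h
  funext i
  fin_cases i
  · exact (sphChi_stereoPoint hp).symm.trans ((congrArg sphChi e).trans (sphChi_stereoPoint hq))
  · exact (sphTheta_stereoPoint hp).symm.trans ((congrArg sphTheta e).trans (sphTheta_stereoPoint hq))
  · exact (sphPhi_stereoPoint hp).symm.trans ((congrArg sphPhi e).trans (sphPhi_stereoPoint hq))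

theorem mem_image_stereoPoint {x : Fin 3 → ℝ} (hx : x 1 ≠ 0) : x ∈ stereoPoint '' coordBox := by
  set r : ℝ := ‖(WithLp.toLp 2 x : E3)‖ with hr
  have hr2 : r ^ 2 = x 0 ^ 2 + x 1 ^ 2 + x 2 ^ 2 := by
    simp [hr, EuclideanSpace.norm_sq_eq, Fin.sum_univ_three]
  have hx1 : 0 < x 1 ^ 2 := by positivity
  have hrpos : 0 < r := by
    refine lt_of_le_of_ne (norm_nonneg _) fun h => ?_
    rw [← h] at hr2
    nlinarith [sq_nonneg (x 0), sq_nonneg (x 2)]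
  have hlt : |x 2 / r| < 1 := by
    rw [abs_div, abs_of_pos hrpos, div_lt_one hrpos]
    exact abs_lt_of_sq_lt_sq (by nlinarith [sq_nonneg (x 0)]) hrpos.le
  rw [abs_lt] at hlt
  set c : ℝ := (r ^ 2 - 1) / (r ^ 2 + 1) with hc
  have hr1 : 0 < r ^ 2 + 1 := by positivity
  have hcl : -1 < c := by rw [hc, lt_div_iff₀ hr1]; nlinarith
  have hcr : c < 1 := by rw [hc, div_lt_one hr1]; linarith
  set z : ℂ := ⟨x 0, x 1⟩ with hz
  have hzn : ‖z‖ = r * sin (arccos (x 2 / r)) := by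
    rw [sin_arccos, ← sqrt_sq hrpos.le, ← sqrt_mul (sq_nonneg r), sqrt_sq hrpos.le]
    rw [Complex.norm_def, Complex.normSq_mk]
    congr 1
    field_simp
    linear_combination -hr2
  have hrad : stereoRadius (arccos c) = r := by
    rw [stereoRadius, cos_arccos hcl.le hcr.le, sin_arccos, div_eq_iff (by linarith)]
    rw [sqrt_eq_iff_mul_self_eq_of_pos (mul_pos hrpos (by linarith)), hc]
    field_simp
    ring
  refine ⟨![arccos c, arccos (x 2 / r), Complex.arg z], mem_coordBox.2 ⟨?_, ?_, ?_⟩, ?_⟩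
  · exact ⟨arccos_pos.2 hcr, arccos_lt_pi.2 hcl⟩
  · exact ⟨arccos_pos.2 hlt.2, arccos_lt_pi.2 hlt.1⟩
  · refine ⟨Complex.neg_pi_lt_arg z, lt_of_le_of_ne (Complex.arg_le_pi z) fun h => ?_⟩
    exact hx (Complex.arg_eq_pi_iff.1 h).2
  · funext i
    fin_cases i
    · simp [stereoPoint, hrad, ← mul_assoc, ← hzn, hz]
    · simp [stereoPoint, hrad, ← mul_assoc, ← hzn, hz]
    · simp [stereoPoint, hrad, cos_arccos hlt.1.le hlt.2.le, mul_div_cancel₀ _ hrpos.ne']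

theorem image_stereoPoint_ae_eq_univ :
    stereoPoint '' coordBox =ᵐ[volume] (Set.univ : Set (Fin 3 → ℝ)) := by
  refine eventuallyEq_univ.2 ?_
  filter_upwards [Measure.ae_eval_ne (fun _ : Fin 3 => (volume : Measure ℝ)) 1 0] with x hx
  exact mem_image_stereoPoint hx

/-- Integration over space in spherical coordinates on the sphere. -/
theorem integral_eq_setIntegral_coordBox (g : E3 → ℝ) :
    ∫ x, g x = ∫ p in coordBox, 1 / (1 - cos (p 0)) * stereoRadius (p 0) ^ 2 * sin (p 1) *
      g (WithLp.toLp 2 (stereoPoint p)) := by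
  rw [← (PiLp.volume_preserving_toLp (Fin 3)).integral_comp
    (MeasurableEquiv.toLp 2 _).measurableEmbedding, ← setIntegral_univ,
    ← setIntegral_congr_set image_stereoPoint_ae_eq_univ,
    integral_image_eq_integral_abs_det_fderiv_smul volume isOpen_coordBox.measurableSet
      (fun p hp => (hasFDerivAt_stereoPoint hp).hasFDerivWithinAt) injOn_stereoPoint]
  refine setIntegral_congr_fun isOpen_coordBox.measurableSet fun p hp => ?_
  obtain ⟨h0, h1, h2⟩ := mem_coordBox.1 hp
  have := one_sub_cos_pos h0
  have := sin_pos_of_mem_Ioo h1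
  simp only [LinearMap.det_toContinuousLinearMap, LinearMap.det_toLin', det_stereoJacobian,
    smul_eq_mul, abs_neg]
  rw [abs_of_nonneg (by positivity)]

/-- The radial polynomial `T_{k+1}^{(ℓ+1)}`. -/
def radialPoly (k l : ℕ) : Polynomial ℝ :=
  Polynomial.derivative^[l + 1] (Polynomial.Chebyshev.T ℝ ((k + 1 : ℕ) : ℤ))

/-- The constant factor of `Wfun α`. -/
def normConst (α : ℕ × ℕ × ℤ) : ℝ :=
  1 / √(akl α.1 α.2.1) * √((2 * α.2.1 + 1) / (2 * π)) *
    √((α.2.1 - α.2.2.natAbs).factorial / (α.2.1 + α.2.2.natAbs).factorial) /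
    (2 ^ α.2.1 * α.2.1.factorial)

theorem Wfun_eq (α : ℕ × ℕ × ℤ) (x : E3) :
    Wfun α x = normConst α * (√(2 / (‖x‖ ^ 2 + 1)) *
      profile α.2.1 (radialPoly α.1 α.2.1) (sphChi x)) *
      profile α.2.2.natAbs (rodrigues α.2.1 α.2.2.natAbs) (sphTheta x) *
      ymfun α.2.2 (sphPhi x) := by
  have hs : √(1 - cos (sphTheta x) ^ 2) = sin (sphTheta x) := by
    rw [← sin_sq]
    exact sqrt_sq (sin_nonneg_of_nonneg_of_le_pi (arccos_nonneg _) (arccos_le_pi _))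
  have h1 : ((-1 : ℝ) ^ α.2.2.natAbs) * (-1 : ℝ) ^ α.2.2.natAbs = 1 := by
    rw [← mul_pow]; simp
  simp only [Wfun, Yfun, Y2fun, Kfun, legendreP, chebDeriv, hs, normConst, profile, radialPoly,
    rodrigues]
  linear_combination (√(2 / (‖x‖ ^ 2 + 1)) * (1 / √(akl α.1 α.2.1)) * sin (sphChi x) ^ α.2.1 *
    (Polynomial.derivative^[α.2.1 + 1]
      (Polynomial.Chebyshev.T ℝ ((α.1 + 1 : ℕ) : ℤ))).eval (cos (sphChi x)) *
    √((2 * α.2.1 + 1) / (2 * π)) *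
    √((α.2.1 - α.2.2.natAbs).factorial / (α.2.1 + α.2.2.natAbs).factorial) /
    (2 ^ α.2.1 * α.2.1.factorial) * sin (sphTheta x) ^ α.2.2.natAbs *
    (Polynomial.derivative^[α.2.1 + α.2.2.natAbs]
      ((Polynomial.X ^ 2 - 1 : Polynomial ℝ) ^ α.2.1)).eval (cos (sphTheta x)) *
    ymfun α.2.2 (sphPhi x)) * h1

theorem differentiableAt_Wfun (α : ℕ × ℕ × ℤ) {p : Fin 3 → ℝ} (hp : p ∈ coordBox) :
    DifferentiableAt ℝ (Wfun α) (WithLp.toLp 2 (stereoPoint p)) := by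
  obtain ⟨h0, h1, h2⟩ := mem_coordBox.1 hp
  have hn := norm_stereoPoint hp
  have hφ := sphPhi_stereoPoint hp
  have hθ := cos_sphTheta_stereoPoint hp
  have hrpos := stereoRadius_pos h0
  have hχ := stereoRadius_sq_sub_one_div h0
  rw [← hn] at hrpos hχ
  set x : E3 := WithLp.toLp 2 (stereoPoint p) with hx
  have hx0 : x ≠ 0 := norm_pos_iff.1 hrpos
  have hcos : ∀ {t : ℝ}, t ∈ Set.Ioo 0 π → cos t ≠ -1 ∧ cos t ≠ 1 := fun {t} ht => by
    have := sin_pos_of_mem_Ioo ht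
    constructor <;> intro h <;> nlinarith [sin_sq_add_cos_sq t]
  have hnd : DifferentiableAt ℝ (fun y : E3 => ‖y‖) x := differentiableAt_id.norm ℝ hx0
  have hcoord : ∀ i : Fin 3, DifferentiableAt ℝ (fun y : E3 => y i) x := fun i => by fun_prop
  have hden : DifferentiableAt ℝ (fun y : E3 => (‖y‖ ^ 2 + 1)⁻¹) x :=
    ((hnd.fun_pow 2).add_const 1).fun_inv (by positivity)
  have dχ : DifferentiableAt ℝ sphChi x := by
    refine (differentiableAt_arccos.2 (hχ ▸ hcos h0)).comp x ?_
    exact ((hnd.fun_pow 2).sub_const 1).fun_mul hden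
  have dθ : DifferentiableAt ℝ sphTheta x := by
    refine (differentiableAt_arccos.2 ?_).comp x ((hcoord 2).fun_mul (hnd.fun_inv hrpos.ne'))
    have := hcos h1
    rw [← hθ] at this
    exact this
  have dφ : DifferentiableAt ℝ sphPhi x := by
    have hz : (⟨x 0, x 1⟩ : ℂ) ∈ Complex.slitPlane := by
      refine Complex.mem_slitPlane_iff_arg.2 ⟨fun h => h2.2.ne (hφ.symm.trans h), fun h => ?_⟩
      have hs := sin_pos_of_mem_Ioo h1
      have e0 : stereoRadius (p 0) * (sin (p 1) * cos (p 2)) = 0 := congrArg Complex.re h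
      have e1 : stereoRadius (p 0) * (sin (p 1) * sin (p 2)) = 0 := congrArg Complex.im h
      have hr0 := (stereoRadius_pos h0).ne'
      simp only [mul_eq_zero, hr0, hs.ne', false_or] at e0 e1
      simpa [e0, e1] using sin_sq_add_cos_sq (p 2)
    have dz : DifferentiableAt ℝ (fun y : E3 => (⟨y 0, y 1⟩ : ℂ)) x := by
      have : (fun y : E3 => (⟨y 0, y 1⟩ : ℂ))
          = fun y => Complex.ofRealCLM (y 0) + Complex.ofRealCLM (y 1) * Complex.I := by
        funext y
        apply Complex.ext <;> simp
      rw [this]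
      fun_prop
    rw [show sphPhi = fun y => (Complex.log ⟨y 0, y 1⟩).im from
      funext fun y => (Complex.log_im _).symm]
    exact Complex.imCLM.differentiableAt.comp x
      (((Complex.hasStrictDerivAt_log hz).hasDerivAt.differentiableAt.restrictScalars ℝ).comp x dz)
  rw [show Wfun α = _ from funext (Wfun_eq α)]
  have d1 : DifferentiableAt ℝ (fun y : E3 => √(2 / (‖y‖ ^ 2 + 1))) x :=
    (hden.const_mul 2).sqrt (by positivity)
  exact (((d1.mul ((hasDerivAt_profile _ _ _).differentiableAt.comp x dχ)).const_mul _).mul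
    ((hasDerivAt_profile _ _ _).differentiableAt.comp x dθ)).mul
    ((hasDerivAt_ymfun _ _).differentiableAt.comp x dφ)

theorem Wfun_stereoPoint (α : ℕ × ℕ × ℤ) {p : Fin 3 → ℝ} (hp : p ∈ coordBox) :
    Wfun α (WithLp.toLp 2 (stereoPoint p)) = normConst α * (√(1 - cos (p 0)) *
      profile α.2.1 (radialPoly α.1 α.2.1) (p 0)) *
      profile α.2.2.natAbs (rodrigues α.2.1 α.2.2.natAbs) (p 1) * ymfun α.2.2 (p 2) := by
  rw [Wfun_eq, norm_stereoPoint hp, stereoRadius_sq_add_one (mem_coordBox.1 hp).1,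
    sphPhi_stereoPoint hp, sphTheta_stereoPoint hp, sphChi_stereoPoint hp,
    div_div_cancel₀ two_ne_zero]

theorem inner_gradient_Wfun_stereoJacobian (α : ℕ × ℕ × ℤ) {p : Fin 3 → ℝ} (hp : p ∈ coordBox)
    (v : Fin 3 → ℝ) :
    ⟪gradient (Wfun α) (WithLp.toLp 2 (stereoPoint p)),
      WithLp.toLp 2 ((stereoJacobian p).mulVec v)⟫ =
    normConst α * (
      (sin (p 0) / (2 * √(1 - cos (p 0))) * profile α.2.1 (radialPoly α.1 α.2.1) (p 0) +
        √(1 - cos (p 0)) * profileDeriv α.2.1 (radialPoly α.1 α.2.1) (p 0)) *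
        profile α.2.2.natAbs (rodrigues α.2.1 α.2.2.natAbs) (p 1) * ymfun α.2.2 (p 2) * v 0 +
      √(1 - cos (p 0)) * profile α.2.1 (radialPoly α.1 α.2.1) (p 0) *
        profileDeriv α.2.2.natAbs (rodrigues α.2.1 α.2.2.natAbs) (p 1) * ymfun α.2.2 (p 2) * v 1 +
      √(1 - cos (p 0)) * profile α.2.1 (radialPoly α.1 α.2.1) (p 0) *
        profile α.2.2.natAbs (rodrigues α.2.1 α.2.2.natAbs) (p 1) *
        (-α.2.2 * ymfun (-α.2.2) (p 2)) * v 2) := by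
  obtain ⟨h0, h1, h2⟩ := mem_coordBox.1 hp
  have hpos := one_sub_cos_pos h0
  have hA : HasDerivAt (fun t => √(1 - cos t) * profile α.2.1 (radialPoly α.1 α.2.1) t)
      (sin (p 0) / (2 * √(1 - cos (p 0))) * profile α.2.1 (radialPoly α.1 α.2.1) (p 0) +
        √(1 - cos (p 0)) * profileDeriv α.2.1 (radialPoly α.1 α.2.1) (p 0)) (p 0) := by
    refine ((((hasDerivAt_cos (p 0)).const_sub 1).sqrt hpos.ne').fun_mul
      (hasDerivAt_profile _ _ _)).congr_deriv ?_
    rw [neg_neg]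
  have hd := fun i => hasFDerivAt_apply (𝕜 := ℝ) (i : Fin 3) p
  have hF := (((hA.comp_hasFDerivAt p (hd 0)).const_mul (normConst α)).fun_mul
    ((hasDerivAt_profile α.2.2.natAbs (rodrigues α.2.1 α.2.2.natAbs) (p 1)).comp_hasFDerivAt p
      (hd 1))).fun_mul ((hasDerivAt_ymfun α.2.2 (p 2)).comp_hasFDerivAt p (hd 2))
  have hG := ((differentiableAt_Wfun α hp).hasFDerivAt.comp (stereoPoint p)
    (PiLp.hasFDerivAt_toLp 2 (stereoPoint p))).comp p (hasFDerivAt_stereoPoint hp)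
  have heq := (hG.congr_of_eventuallyEq (f := _) (Filter.EventuallyEq.symm ?_)).unique hF
  · have := congrArg (fun L => L v) heq
    rw [gradient, InnerProductSpace.toDual_symm_apply]
    refine Eq.trans (by simp) (this.trans ?_)
    simp
    ring
  · filter_upwards [isOpen_coordBox.mem_nhds hp] with q hq
    exact Wfun_stereoPoint α hq

theorem inner_eq_stereoFrame (θ φ : ℝ) (u v : E3) :
    ⟪u, v⟫ =
      (u 0 * (sin θ * cos φ) + u 1 * (sin θ * sin φ) + u 2 * cos θ) *
        (v 0 * (sin θ * cos φ) + v 1 * (sin θ * sin φ) + v 2 * cos θ) +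
      (u 0 * (cos θ * cos φ) + u 1 * (cos θ * sin φ) - u 2 * sin θ) *
        (v 0 * (cos θ * cos φ) + v 1 * (cos θ * sin φ) - v 2 * sin θ) +
      (u 1 * cos φ - u 0 * sin φ) * (v 1 * cos φ - v 0 * sin φ) := by
  have hθ := sin_sq_add_cos_sq θ
  have hφ := sin_sq_add_cos_sq φ
  simp only [PiLp.inner_apply, Fin.sum_univ_three, RCLike.inner_apply, conj_trivial]
  linear_combination -((u 0 * cos φ + u 1 * sin φ) * (v 0 * cos φ + v 1 * sin φ) + u 2 * v 2) * hθ
    - (u 0 * v 0 + u 1 * v 1) * hφ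

theorem gradient_Wfun_stereoFrame (α : ℕ × ℕ × ℤ) {p : Fin 3 → ℝ} (hp : p ∈ coordBox) :
    let u := gradient (Wfun α) (WithLp.toLp 2 (stereoPoint p))
    u 0 * (sin (p 1) * cos (p 2)) + u 1 * (sin (p 1) * sin (p 2)) + u 2 * cos (p 1) =
      -(1 - cos (p 0)) * (normConst α *
        ((sin (p 0) / (2 * √(1 - cos (p 0))) * profile α.2.1 (radialPoly α.1 α.2.1) (p 0) +
          √(1 - cos (p 0)) * profileDeriv α.2.1 (radialPoly α.1 α.2.1) (p 0)) *
        profile α.2.2.natAbs (rodrigues α.2.1 α.2.2.natAbs) (p 1) * ymfun α.2.2 (p 2))) ∧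
    u 0 * (cos (p 1) * cos (p 2)) + u 1 * (cos (p 1) * sin (p 2)) - u 2 * sin (p 1) =
      (stereoRadius (p 0))⁻¹ * (normConst α *
        (√(1 - cos (p 0)) * profile α.2.1 (radialPoly α.1 α.2.1) (p 0) *
        profileDeriv α.2.2.natAbs (rodrigues α.2.1 α.2.2.natAbs) (p 1) * ymfun α.2.2 (p 2))) ∧
    u 1 * cos (p 2) - u 0 * sin (p 2) =
      (stereoRadius (p 0) * sin (p 1))⁻¹ * (normConst α *
        (√(1 - cos (p 0)) * profile α.2.1 (radialPoly α.1 α.2.1) (p 0) *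
        profile α.2.2.natAbs (rodrigues α.2.1 α.2.2.natAbs) (p 1) *
        (-α.2.2 * ymfun (-α.2.2) (p 2)))) := by
  intro u
  obtain ⟨h0, h1, h2⟩ := mem_coordBox.1 hp
  have hpos := one_sub_cos_pos h0
  have hrad := stereoRadius_pos h0
  have hs1 := sin_pos_of_mem_Ioo h1
  have hJ := fun i : Fin 3 => inner_gradient_Wfun_stereoJacobian α hp (Pi.single i 1)
  have e0 := hJ 0
  have e1 := hJ 1
  have e2 := hJ 2
  simp only [PiLp.inner_apply, Fin.sum_univ_three, RCLike.inner_apply, conj_trivial,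
    Matrix.mulVec_single_one, Matrix.col_apply, stereoJacobian, Matrix.of_apply, Matrix.cons_val,
    Pi.single_eq_same, Pi.single_eq_of_ne (show (0 : Fin 3) ≠ 1 by decide),
    Pi.single_eq_of_ne (show (0 : Fin 3) ≠ 2 by decide),
    Pi.single_eq_of_ne (show (1 : Fin 3) ≠ 0 by decide),
    Pi.single_eq_of_ne (show (1 : Fin 3) ≠ 2 by decide),
    Pi.single_eq_of_ne (show (2 : Fin 3) ≠ 0 by decide),
    Pi.single_eq_of_ne (show (2 : Fin 3) ≠ 1 by decide), mul_zero, mul_one, add_zero,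
    zero_add, zero_mul] at e0 e1 e2
  refine ⟨?_, ?_, ?_⟩
  · rw [← e0]
    field_simp
    ring
  · rw [← e1]
    field_simp
    ring
  · rw [← e2]
    field_simp
    ring

theorem jacobian_mul_inner_gradient (α β : ℕ × ℕ × ℤ) {p : Fin 3 → ℝ} (hp : p ∈ coordBox) :
    1 / (1 - cos (p 0)) * stereoRadius (p 0) ^ 2 * sin (p 1) *
      ⟪gradient (Wfun α) (WithLp.toLp 2 (stereoPoint p)),
        gradient (Wfun β) (WithLp.toLp 2 (stereoPoint p))⟫ =
    normConst α * normConst β * (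
      stereoDeriv α.2.1 (radialPoly α.1 α.2.1) (p 0) *
        stereoDeriv β.2.1 (radialPoly β.1 β.2.1) (p 0) *
        (profile α.2.2.natAbs (rodrigues α.2.1 α.2.2.natAbs) (p 1) *
          profile β.2.2.natAbs (rodrigues β.2.1 β.2.2.natAbs) (p 1) * sin (p 1)) *
        (ymfun α.2.2 (p 2) * ymfun β.2.2 (p 2)) +
      profile α.2.1 (radialPoly α.1 α.2.1) (p 0) * profile β.2.1 (radialPoly β.1 β.2.1) (p 0) *
        (profileDeriv α.2.2.natAbs (rodrigues α.2.1 α.2.2.natAbs) (p 1) *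
          profileDeriv β.2.2.natAbs (rodrigues β.2.1 β.2.2.natAbs) (p 1) * sin (p 1)) *
        (ymfun α.2.2 (p 2) * ymfun β.2.2 (p 2)) +
      profile α.2.1 (radialPoly α.1 α.2.1) (p 0) * profile β.2.1 (radialPoly β.1 β.2.1) (p 0) *
        (α.2.2 * β.2.2 * (sin (p 1) ^ (α.2.2.natAbs + β.2.2.natAbs - 1) *
          ((rodrigues α.2.1 α.2.2.natAbs).eval (cos (p 1)) *
            (rodrigues β.2.1 β.2.2.natAbs).eval (cos (p 1))))) *
        (ymfun (-α.2.2) (p 2) * ymfun (-β.2.2) (p 2))) := by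
  obtain ⟨h0, h1, h2⟩ := mem_coordBox.1 hp
  have hpos := one_sub_cos_pos h0
  have hs0 := sin_pos_of_mem_Ioo h0
  have hs1 := sin_pos_of_mem_Ioo h1
  have hprod : (α.2.2 : ℝ) * β.2.2 * (sin (p 1) ^ (α.2.2.natAbs + β.2.2.natAbs - 1) *
      ((rodrigues α.2.1 α.2.2.natAbs).eval (cos (p 1)) *
        (rodrigues β.2.1 β.2.2.natAbs).eval (cos (p 1)))) =
      α.2.2 * β.2.2 * (profile α.2.2.natAbs (rodrigues α.2.1 α.2.2.natAbs) (p 1) *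
        profile β.2.2.natAbs (rodrigues β.2.1 β.2.2.natAbs) (p 1) / sin (p 1)) := by
    by_cases hm : α.2.2 = 0
    · simp [hm]
    · obtain ⟨n, hn⟩ : ∃ n, α.2.2.natAbs = n + 1 :=
        Nat.exists_eq_succ_of_ne_zero (Int.natAbs_ne_zero.2 hm)
      rw [profile, profile, hn, show n + 1 + β.2.2.natAbs - 1 = n + β.2.2.natAbs by omega]
      field_simp
      ring
  obtain ⟨a0, a1, a2⟩ := gradient_Wfun_stereoFrame α hp
  obtain ⟨b0, b1, b2⟩ := gradient_Wfun_stereoFrame β hp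
  have hr := sqrt_pos.2 hpos
  have hrsq := sq_sqrt hpos.le
  have hssq : sin (p 0) ^ 2 = (1 + cos (p 0)) * (1 - cos (p 0)) := by rw [sin_sq]; ring
  rw [hprod, inner_eq_stereoFrame (p 1) (p 2), a0, a1, a2, b0, b1, b2]
  have key : ∀ (l : ℕ) (P : Polynomial ℝ), stereoDeriv l P (p 0) = sin (p 0) / √(1 - cos (p 0)) *
      (sin (p 0) / (2 * √(1 - cos (p 0))) * profile l P (p 0) +
        √(1 - cos (p 0)) * profileDeriv l P (p 0)) := fun l P => by
    rw [stereoDeriv]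
    field_simp
    rw [hrsq]
    linear_combination -profile l P (p 0) * hssq
  rw [key, key, stereoRadius, ← hrsq]
  simp only [sqrt_sq hr.le]
  field_simp

theorem setIntegral_coordBox_mul (f g h : ℝ → ℝ) :
    ∫ p in coordBox, f (p 0) * g (p 1) * h (p 2)
      = (∫ t in (0)..π, f t) * (∫ t in (0)..π, g t) * ∫ t in (-π)..π, h t := by
  have hπ := pi_pos
  have hi := integral_fin_nat_prod_eq_prod (𝕜 := ℝ)
    (μ := fun i : Fin 3 => (volume : Measure ℝ).restrict (Set.Ioo (![0, 0, -π] i) π)) ![f, g, h]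
  rw [← Measure.restrict_pi_pi] at hi
  simp only [Fin.prod_univ_three, Matrix.cons_val] at hi
  rw [intervalIntegral.integral_of_le hπ.le, intervalIntegral.integral_of_le hπ.le,
    intervalIntegral.integral_of_le (by linarith), integral_Ioc_eq_integral_Ioo,
    integral_Ioc_eq_integral_Ioo, integral_Ioc_eq_integral_Ioo]
  exact hi

theorem integrableOn_coordBox {F : (Fin 3 → ℝ) → ℝ} (hF : Continuous F) :
    IntegrableOn F coordBox := by
  refine (hF.continuousOn.integrableOn_compact
    (isCompact_univ_pi fun i => isCompact_Icc (a := ![0, 0, -π] i) (b := π))).mono_set ?_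
  exact Set.pi_mono fun i _ => Set.Ioo_subset_Icc_self

theorem integral_inner_gradient_Wfun (k l k' l' : ℕ) (m m' : ℤ) :
    ∫ x : E3, ⟪gradient (Wfun (k, l, m)) x, gradient (Wfun (k', l', m')) x⟫ =
    normConst (k, l, m) * normConst (k', l', m') * (
      ((∫ t in (0)..π, stereoDeriv l (radialPoly k l) t * stereoDeriv l' (radialPoly k' l') t) *
        (∫ t in (0)..π, profile m.natAbs (rodrigues l m.natAbs) t *
          profile m'.natAbs (rodrigues l' m'.natAbs) t * sin t) *
        ∫ t in (-π)..π, ymfun m t * ymfun m' t) +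
      ((∫ t in (0)..π, profile l (radialPoly k l) t * profile l' (radialPoly k' l') t) *
        (∫ t in (0)..π, profileDeriv m.natAbs (rodrigues l m.natAbs) t *
          profileDeriv m'.natAbs (rodrigues l' m'.natAbs) t * sin t) *
        ∫ t in (-π)..π, ymfun m t * ymfun m' t) +
      ((∫ t in (0)..π, profile l (radialPoly k l) t * profile l' (radialPoly k' l') t) *
        (∫ t in (0)..π, m * m' * (sin t ^ (m.natAbs + m'.natAbs - 1) *
          ((rodrigues l m.natAbs).eval (cos t) * (rodrigues l' m'.natAbs).eval (cos t)))) *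
        ∫ t in (-π)..π, ymfun (-m) t * ymfun (-m') t)) := by
  rw [integral_eq_setIntegral_coordBox, setIntegral_congr_fun isOpen_coordBox.measurableSet
    fun p hp => jacobian_mul_inner_gradient (k, l, m) (k', l', m') hp, integral_const_mul,
    ← setIntegral_coordBox_mul, ← setIntegral_coordBox_mul, ← setIntegral_coordBox_mul,
    ← integral_add, ← integral_add]
  all_goals exact integrableOn_coordBox (by fun_prop)

theorem isUltraspherical_radialPoly (k l : ℕ) :
    IsUltraspherical (2 * l + 2) ((k + 1) ^ 2 - (l + 1) ^ 2) (radialPoly k l) := by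
  have h := isUltraspherical_iterate_derivative_T ((k + 1 : ℕ) : ℤ) (l + 1)
  push_cast at h
  exact h

theorem sinPairing_radialPoly {k l : ℕ} (hl : l ≤ k) :
    sinPairing (2 * l + 2) (radialPoly k l) (radialPoly k l) = akl k l := by
  rw [akl, eq_div_iff (by positivity)]
  have h := sinPairing_iterate_derivative_T k (l + 1) (by omega)
  rw [Nat.add_sub_add_right] at h
  exact h

theorem sinPairing_rodrigues_eq_zero {l l' : ℕ} (h : l ≠ l') (n : ℕ) :
    sinPairing (2 * n + 1) (rodrigues l n) (rodrigues l' n) = 0 := by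
  refine (isUltraspherical_rodrigues l n).sinPairing_eq_zero (isUltraspherical_rodrigues l' n)
    fun e => h ?_
  have : (l : ℝ) = l' := by
    have h0 : (0 : ℝ) < l + l' + 1 := by positivity
    have : ((l : ℝ) - l') * (l + l' + 1) = 0 := by linear_combination e
    exact sub_eq_zero.1 ((mul_eq_zero.1 this).resolve_right h0.ne')
  exact_mod_cast this

theorem sinPairing_radialPoly_eq_zero {k k' : ℕ} (h : k ≠ k') (l : ℕ) :
    sinPairing (2 * l + 2) (radialPoly k l) (radialPoly k' l) = 0 := by
  refine (isUltraspherical_radialPoly k l).sinPairing_eq_zero (isUltraspherical_radialPoly k' l)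
    fun e => h ?_
  have : (k : ℝ) = k' := by
    have h0 : (0 : ℝ) < k + k' + 2 := by positivity
    have : ((k : ℝ) - k') * (k + k' + 2) = 0 := by linear_combination e
    exact sub_eq_zero.1 ((mul_eq_zero.1 this).resolve_right h0.ne')
  exact_mod_cast this

theorem normConst_sq_mul {k l : ℕ} {m : ℤ} (hl : l ≤ k) (hm : m.natAbs ≤ l) :
    normConst (k, l, m) ^ 2 * (π *
      sinPairing (2 * m.natAbs + 1) (rodrigues l m.natAbs) (rodrigues l m.natAbs) *
      sinPairing (2 * l + 2) (radialPoly k l) (radialPoly k l)) = 1 := by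
  have hR := sinPairing_rodrigues l m.natAbs hm
  rw [← eq_div_iff (by positivity)] at hR
  have ha : 0 < akl k l := by unfold akl; positivity
  rw [sinPairing_radialPoly hl, hR]
  simp only [normConst, div_pow, mul_pow, one_pow]
  rw [sq_sqrt ha.le, sq_sqrt (by positivity), sq_sqrt (by positivity)]
  field_simp

theorem integral_inner_gradient_Wfun_eq (k l k' l' : ℕ) (m : ℤ) :
    ∫ x : E3, ⟪gradient (Wfun (k, l, m)) x, gradient (Wfun (k', l', m)) x⟫ =
    normConst (k, l, m) * normConst (k', l', m) * (π *
      sinPairing (2 * m.natAbs + 1) (rodrigues l m.natAbs) (rodrigues l' m.natAbs) *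
      ∫ t in (0)..π, (stereoDeriv l (radialPoly k l) t * stereoDeriv l' (radialPoly k' l') t +
        l * (l + 1) * (profile l (radialPoly k l) t * profile l' (radialPoly k' l') t))) := by
  have hpol := (isUltraspherical_rodrigues l m.natAbs).integral_polar_form
    (rodrigues l' m.natAbs)
  have h0 := integral_profile_mul_sin m.natAbs 1 (rodrigues l m.natAbs) (rodrigues l' m.natAbs)
  have hm : (m.natAbs : ℝ) ^ 2 = m * m := by
    rw [Nat.cast_natAbs, Int.cast_abs, sq_abs, sq]
  rw [intervalIntegral.integral_add (Continuous.intervalIntegrable (by fun_prop) _ _)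
    (Continuous.intervalIntegrable (by fun_prop) _ _), hm] at hpol
  simp only [pow_one] at h0
  rw [integral_inner_gradient_Wfun, integral_ymfun_mul, integral_ymfun_mul, if_pos rfl, if_pos rfl,
    intervalIntegral.integral_add (Continuous.intervalIntegrable (by fun_prop) _ _)
    (Continuous.intervalIntegrable (by fun_prop) _ _), h0]
  simp only [intervalIntegral.integral_const_mul] at hpol ⊢
  linear_combination normConst (k, l, m) * normConst (k', l', m) * π *
    (∫ t in (0)..π, profile l (radialPoly k l) t * profile l' (radialPoly k' l') t) * hpol

/-- Gradient orthogonality: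
`∫_{ℝ³} ∇𝒲_α · ∇𝒲_β dx = ((2k+1)(2k+3)/4) δ_{αβ}` for `α ∈ Λ_k` and `β ∈ Λ`. -/
theorem AB_gradient_orthogonality (k : ℕ) (α : ℕ × ℕ × ℤ) (hα : memLam α) (hk : α.1 = k)
    (β : ℕ × ℕ × ℤ) (hβ : memLam β) :
    (∫ x : E3, ⟪gradient (Wfun α) x, gradient (Wfun β) x⟫)
      = ((2*(k:ℝ)+1) * (2*(k:ℝ)+3) / 4) * (if α = β then (1:ℝ) else 0) := by
  obtain ⟨k, l, m⟩ := α
  obtain ⟨k', l', m'⟩ := β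
  subst hk
  obtain ⟨hl, hm⟩ := hα
  by_cases hmm : m = m'
  · subst hmm
    rw [integral_inner_gradient_Wfun_eq]
    by_cases hll : l = l'
    · subst hll
      rw [(isUltraspherical_radialPoly k l).integral_radial_form]
      by_cases hkk : k = k'
      · subst hkk
        rw [if_pos rfl]
        linear_combination ((2 * (k : ℝ) + 1) * (2 * k + 3) / 4) * normConst_sq_mul hl hm
      · rw [sinPairing_radialPoly_eq_zero hkk, if_neg (by simp [hkk])]
        ring
    · rw [sinPairing_rodrigues_eq_zero hll, if_neg (by simp [hll])]
      ring
  · rw [integral_inner_gradient_Wfun, integral_ymfun_mul, integral_ymfun_mul, if_neg hmm,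
      if_neg (neg_injective.ne hmm), if_neg (by simp [hmm])]
    ring

end
end
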